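/- Lower bound for restricted low-temperature dynamics: assume β > 1. For the Glauber dynamics restricted to configurations with non-negative magnetization, the mixing time satisfies t_mix(n) ≥ (1/4)·n·log n for all sufficiently large n. -/

import Mathlib

open Filter Real

namespace CW

/-- Configurations of the Curie-Weiss model on `n` vertices:
`true` encodes spin `+1` and `false` encodes spin `-1`. -/
abbrev Config (n : ℕ) := Fin n → Bool

noncomputable section

/-- The spin (±1) at site `i`. -/
def spin {n : ℕ} (σ : Config n) (i : Fin n) : ℝ := if σ i then 1 else -1

/-- Normalized magnetization `S(σ) = n⁻¹ ∑ᵢ σ(i)`. -/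
def mag {n : ℕ} (σ : Config n) : ℝ := (∑ i, spin σ i) / n

/-- `p₊(s) = (1 + tanh(βs))/2`. -/
def pPlus (β s : ℝ) : ℝ := (1 + Real.tanh (β * s)) / 2

/-- One-step transition kernel of the Glauber dynamics for the Curie-Weiss
model: a uniformly chosen site `i` is refreshed, becoming `+1` with
probability `p₊(S(σ) - σ(i)/n)`. -/
def glauberKernel (β : ℝ) (n : ℕ) (σ η : Config n) : ℝ :=
  (1 / n) * ∑ i : Fin n,
    if ∀ j, j ≠ i → η j = σ j then
      (if η i then pPlus β (mag σ - spin σ i / n)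
       else 1 - pPlus β (mag σ - spin σ i / n))
    else 0

/-- Law of the Glauber dynamics at time `t` started from `σ`. -/
def glauberLaw (β : ℝ) (n : ℕ) : ℕ → Config n → Config n → ℝ
  | 0, σ, η => if η = σ then 1 else 0
  | t + 1, σ, η => ∑ τ : Config n, glauberLaw β n t σ τ * glauberKernel β n τ η

/-- The (normalized) exponent in the Curie-Weiss measure. -/
def cwExponent {n : ℕ} (β : ℝ) (σ : Config n) : ℝ :=
  (β / n) * ∑ i : Fin n, ∑ j : Fin n, if i < j then spin σ i * spin σ j else 0

/-- The Curie-Weiss (mean-field Ising) probability measure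
`μ(σ) = Z(β)⁻¹ exp((β/n) ∑_{i<j} σ(i)σ(j))`. -/
def cwMeasure (β : ℝ) (n : ℕ) (σ : Config n) : ℝ :=
  Real.exp (cwExponent β σ) / ∑ η : Config n, Real.exp (cwExponent β η)

/-- Total variation distance between two (discrete) distributions. -/
def tvDist {Ω : Type*} [Fintype Ω] (μ ν : Ω → ℝ) : ℝ :=
  (∑ x, |μ x - ν x|) / 2

/-- Worst-case total variation distance to stationarity at time `t`. -/
def glauberDist (β : ℝ) (n t : ℕ) : ℝ :=
  ⨆ σ : Config n, tvDist (glauberLaw β n t σ) (cwMeasure β n)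

/-- The global spin flip `σ ↦ -σ`. -/
def negConfig {n : ℕ} (σ : Config n) : Config n := fun i => !(σ i)

/-- Transition kernel of the Glauber dynamics restricted to the set
`Ω⁺ = {σ : S(σ) ≥ 0}`: a candidate move `η'` is generated by the Glauber
dynamics; if `S(η') ≥ 0` the chain moves to `η'`, otherwise it moves
to `-η'`. -/
def rKernel (β : ℝ) (n : ℕ) (σ η : Config n) : ℝ :=
  (if 0 ≤ mag η then glauberKernel β n σ η else 0) +
    (if mag (negConfig η) < 0 then glauberKernel β n σ (negConfig η) else 0)

/-- Law of the restricted Glauber dynamics at time `t` started from `σ`. -/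
def rLaw (β : ℝ) (n : ℕ) : ℕ → Config n → Config n → ℝ
  | 0, σ, η => if η = σ then 1 else 0
  | t + 1, σ, η => ∑ τ : Config n, rLaw β n t σ τ * rKernel β n τ η

/-- The stationary distribution `μ⁺` of the restricted dynamics: the image of
the Curie-Weiss measure `μ` under the folding map `σ ↦ σ` if `S(σ) ≥ 0`,
`σ ↦ -σ` otherwise. -/
def muPlus (β : ℝ) (n : ℕ) (η : Config n) : ℝ :=
  ∑ σ : Config n,
    if (if 0 ≤ mag σ then σ else negConfig σ) = η then cwMeasure β n σ else 0

/-- Worst-case total variation distance to stationarity for the restricted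
dynamics, the maximum being over starting states in `Ω⁺`. -/
def rDist (β : ℝ) (n t : ℕ) : ℝ :=
  ⨆ σ : {σ : Config n // 0 ≤ mag σ}, tvDist (rLaw β n t σ.1) (muPlus β n)

/-- Mixing time of the restricted Glauber dynamics. -/
def rTMix (β : ℝ) (n : ℕ) : ℕ := sInf {t | rDist β n t ≤ 1 / 4}
/-! ### Monotonicity and Lipschitz bound for the hyperbolic tangent -/

lemma hasDerivAt_tanh (x : ℝ) : HasDerivAt Real.tanh (1 / Real.cosh x ^ 2) x := by
  have h := (Real.hasDerivAt_sinh x).div (Real.hasDerivAt_cosh x) (Real.cosh_pos x).ne'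
  have h2 : Real.cosh x * Real.cosh x - Real.sinh x * Real.sinh x = 1 := by
    have := Real.cosh_sq x
    nlinarith
  rw [h2] at h
  have h3 : Real.tanh = Real.sinh / Real.cosh := by
    funext y
    simp [Real.tanh_eq_sinh_div_cosh]
  rw [h3]
  exact h

lemma tanh_monotone : Monotone Real.tanh := by
  refine monotone_of_deriv_nonneg (fun x => (hasDerivAt_tanh x).differentiableAt) fun x => ?_
  rw [(hasDerivAt_tanh x).deriv]
  positivity

lemma tanh_sub_tanh_le {x y : ℝ} (h : x ≤ y) : Real.tanh y - Real.tanh x ≤ y - x := by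
  have hd : ∀ z, HasDerivAt (fun z => z - Real.tanh z) (1 - 1 / Real.cosh z ^ 2) z :=
    fun z => (hasDerivAt_id z).sub (hasDerivAt_tanh z)
  have hm : Monotone fun z => z - Real.tanh z := by
    refine monotone_of_deriv_nonneg (fun z => (hd z).differentiableAt) fun z => ?_
    rw [(hd z).deriv, sub_nonneg]
    exact div_le_one_of_le₀ (one_le_pow₀ (Real.one_le_cosh z)) (by positivity)
  have := hm h
  simp only at this
  linarith

lemma pPlus_pos (β s : ℝ) : 0 < pPlus β s := by
  have := Real.neg_one_lt_tanh (β * s)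
  unfold pPlus
  linarith

lemma pPlus_lt_one (β s : ℝ) : pPlus β s < 1 := by
  have := Real.tanh_lt_one (β * s)
  unfold pPlus
  linarith

lemma pPlus_neg (β s : ℝ) : pPlus β (-s) = 1 - pPlus β s := by
  unfold pPlus
  rw [mul_neg, Real.tanh_neg]
  ring

lemma exp_mul_one_sub_pPlus (β h : ℝ) :
    Real.exp (β * h) * (1 - pPlus β h) = Real.exp (-(β * h)) * pPlus β h := by
  unfold pPlus
  rw [Real.tanh_eq]
  have h1 := Real.exp_pos (β * h)
  have h2 := Real.exp_pos (-(β * h))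
  field_simp
  ring

/-! ### Symmetries of the magnetization, the kernel and the measure -/

lemma spin_sq {n : ℕ} (σ : Config n) (i : Fin n) : spin σ i * spin σ i = 1 := by
  unfold spin; split_ifs <;> norm_num

lemma spin_negConfig {n : ℕ} (σ : Config n) (i : Fin n) :
    spin (negConfig σ) i = -spin σ i := by
  unfold spin negConfig; cases σ i <;> simp

lemma negConfig_negConfig {n : ℕ} (σ : Config n) : negConfig (negConfig σ) = σ := by
  funext i; simp [negConfig]

lemma negConfig_eq_iff {n : ℕ} (σ η : Config n) : negConfig σ = η ↔ σ = negConfig η :=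
  ⟨fun h => by rw [← h, negConfig_negConfig], fun h => by rw [h, negConfig_negConfig]⟩

/-- The global spin flip as a permutation of the configurations. -/
def negEquiv (n : ℕ) : Equiv.Perm (Config n) :=
  Function.Involutive.toPerm negConfig negConfig_negConfig

lemma sum_negConfig {n : ℕ} (g : Config n → ℝ) : ∑ σ, g (negConfig σ) = ∑ σ, g σ :=
  Equiv.sum_comp (negEquiv n) g

lemma mag_negConfig {n : ℕ} (σ : Config n) : mag (negConfig σ) = -mag σ := by
  unfold mag
  simp [spin_negConfig, neg_div]

lemma spin_comp {n : ℕ} (σ : Config n) (e : Equiv.Perm (Fin n)) (i : Fin n) :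
    spin (σ ∘ e) i = spin σ (e i) := rfl

lemma mag_comp {n : ℕ} (σ : Config n) (e : Equiv.Perm (Fin n)) : mag (σ ∘ e) = mag σ := by
  unfold mag
  simp only [spin_comp]
  rw [Equiv.sum_comp e (spin σ)]

lemma glauberKernel_negConfig (β : ℝ) {n : ℕ} (σ η : Config n) :
    glauberKernel β n (negConfig σ) (negConfig η) = glauberKernel β n σ η := by
  unfold glauberKernel
  congr 1
  refine Finset.sum_congr rfl fun i _ => ?_
  have h1 : (∀ j, j ≠ i → negConfig η j = negConfig σ j) ↔ ∀ j, j ≠ i → η j = σ j := by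
    simp [negConfig]
  have h2 : mag (negConfig σ) - spin (negConfig σ) i / n = -(mag σ - spin σ i / n) := by
    rw [mag_negConfig, spin_negConfig]
    ring
  rw [h2, pPlus_neg]
  simp only [h1]
  cases h : η i <;> simp [negConfig, h]

lemma glauberKernel_comp (β : ℝ) {n : ℕ} (σ η : Config n) (e : Equiv.Perm (Fin n)) :
    glauberKernel β n (σ ∘ e) (η ∘ e) = glauberKernel β n σ η := by
  unfold glauberKernel
  congr 1
  refine Fintype.sum_equiv e _ _ fun i => ?_
  have h1 : (∀ j, j ≠ i → (η ∘ e) j = (σ ∘ e) j) ↔ ∀ j, j ≠ e i → η j = σ j := by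
    constructor
    · intro h j hj
      have := h (e.symm j) (fun h' => hj (by simp [← h']))
      simpa using this
    · intro h j hj
      exact h (e j) fun h' => hj (e.injective h')
  simp only [h1]
  simp only [mag_comp, spin_comp, Function.comp_apply]

lemma cwExponent_eq (β : ℝ) {n : ℕ} (σ : Config n) :
    cwExponent β σ = β / n * (((∑ i, spin σ i) ^ 2 - n) / 2) := by
  unfold cwExponent
  congr 1
  have hsymm : ∑ i : Fin n, ∑ j : Fin n, (if j < i then spin σ i * spin σ j else 0) =
      ∑ i : Fin n, ∑ j : Fin n, if i < j then spin σ i * spin σ j else 0 := by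
    rw [Finset.sum_comm]
    refine Finset.sum_congr rfl fun i _ => Finset.sum_congr rfl fun j _ => ?_
    rw [mul_comm]
  have hdiag : ∑ i : Fin n, ∑ j : Fin n, (if i = j then spin σ i * spin σ j else 0) = n := by
    simp [spin_sq]
  have hall : (∑ i, spin σ i) ^ 2 =
      ∑ i : Fin n, ∑ j : Fin n, ((if j < i then spin σ i * spin σ j else 0) +
        (if i = j then spin σ i * spin σ j else 0) +
        (if i < j then spin σ i * spin σ j else 0)) := by
    rw [sq, Finset.sum_mul_sum]
    refine Finset.sum_congr rfl fun i _ => Finset.sum_congr rfl fun j _ => ?_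
    rcases lt_trichotomy i j with h | h | h
    · simp [h, h.not_gt, h.ne]
    · simp [h]
    · simp [h, h.not_gt, h.ne']
  simp only [Finset.sum_add_distrib] at hall
  rw [hsymm, hdiag] at hall
  linarith

lemma cwMeasure_comp (β : ℝ) {n : ℕ} (σ : Config n) (e : Equiv.Perm (Fin n)) :
    cwMeasure β n (σ ∘ e) = cwMeasure β n σ := by
  unfold cwMeasure
  simp only [cwExponent_eq, spin_comp]
  rw [Equiv.sum_comp e (spin σ)]

lemma cwMeasure_nonneg (β : ℝ) {n : ℕ} (σ : Config n) : 0 ≤ cwMeasure β n σ :=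
  div_nonneg (Real.exp_pos _).le (Finset.sum_nonneg fun _ _ => (Real.exp_pos _).le)

lemma sum_cwMeasure (β : ℝ) (n : ℕ) : ∑ σ, cwMeasure β n σ = 1 := by
  unfold cwMeasure
  rw [← Finset.sum_div]
  exact div_self (Finset.sum_pos (fun _ _ => Real.exp_pos _) Finset.univ_nonempty).ne'

/-! ### One step of the Glauber dynamics -/

lemma sum_eq_off_site {n : ℕ} (σ : Config n) (i : Fin n) (F : Config n → ℝ) :
    (∑ η : Config n, if ∀ j, j ≠ i → η j = σ j then F η else 0) =
      F (Function.update σ i true) + F (Function.update σ i false) := by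
  classical
  have hset : (Finset.univ.filter fun η : Config n => ∀ j, j ≠ i → η j = σ j) =
      {Function.update σ i true, Function.update σ i false} := by
    ext η
    simp only [Finset.mem_filter, Finset.mem_univ, true_and, Finset.mem_insert,
      Finset.mem_singleton, Function.eq_update_iff]
    cases h : η i <;> simp
  rw [← Finset.sum_filter, hset, Finset.sum_pair]
  intro h
  have := congrFun h i
  simp at this

lemma sum_glauberKernel_mul (β : ℝ) {n : ℕ} (σ : Config n) (g : Config n → ℝ) :
    ∑ η, glauberKernel β n σ η * g η = (1 / n) * ∑ i : Fin n,
      (pPlus β (mag σ - spin σ i / n) * g (Function.update σ i true) +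
        (1 - pPlus β (mag σ - spin σ i / n)) * g (Function.update σ i false)) := by
  unfold glauberKernel
  simp only [mul_assoc, Finset.sum_mul]
  rw [← Finset.mul_sum, Finset.sum_comm]
  congr 1
  refine Finset.sum_congr rfl fun i _ => ?_
  simp only [ite_mul, zero_mul]
  rw [sum_eq_off_site σ i (fun η => if η i = true then pPlus β (mag σ - spin σ i / n) * g η
    else (1 - pPlus β (mag σ - spin σ i / n)) * g η)]
  simp

lemma glauberKernel_nonneg (β : ℝ) {n : ℕ} (σ η : Config n) : 0 ≤ glauberKernel β n σ η := by
  unfold glauberKernel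
  refine mul_nonneg (by positivity) (Finset.sum_nonneg fun i _ => ?_)
  have h1 := pPlus_pos β (mag σ - spin σ i / n)
  have h2 := pPlus_lt_one β (mag σ - spin σ i / n)
  split_ifs <;> linarith

lemma glauberKernel_pos (β : ℝ) {n : ℕ} (σ η : Config n) (i : Fin n)
    (h : ∀ j, j ≠ i → η j = σ j) : 0 < glauberKernel β n σ η := by
  have hn : 0 < (n : ℝ) := Nat.cast_pos.2 i.pos
  unfold glauberKernel
  refine mul_pos (by positivity) (Finset.sum_pos' (fun k _ => ?_) ⟨i, Finset.mem_univ _, ?_⟩)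
  · have h1 := pPlus_pos β (mag σ - spin σ k / n)
    have h2 := pPlus_lt_one β (mag σ - spin σ k / n)
    split_ifs <;> linarith
  · have h1 := pPlus_pos β (mag σ - spin σ i / n)
    have h2 := pPlus_lt_one β (mag σ - spin σ i / n)
    rw [if_pos h]
    split_ifs <;> linarith

lemma sum_glauberKernel (β : ℝ) {n : ℕ} (hn : 0 < n) (σ : Config n) :
    ∑ η, glauberKernel β n σ η = 1 := by
  have h := sum_glauberKernel_mul β σ (fun _ => 1)
  have hn' : (n : ℝ) ≠ 0 := by positivity
  simp only [mul_one, add_sub_cancel, Finset.sum_const, Finset.card_univ, Fintype.card_fin,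
    nsmul_eq_mul] at h
  rw [h]
  field_simp

/-! ### Reversibility and stationarity of the Curie-Weiss measure -/

lemma mag_sub_spin_div {n : ℕ} (σ : Config n) (i : Fin n) :
    mag σ - spin σ i / n = (∑ j ∈ Finset.univ.erase i, spin σ j) / n := by
  unfold mag
  rw [← Finset.add_sum_erase _ (spin σ) (Finset.mem_univ i)]
  ring

lemma exp_cwExponent_eq (β : ℝ) {n : ℕ} (σ : Config n) (i : Fin n) :
    Real.exp (cwExponent β σ) =
      Real.exp (β / n * (((∑ j ∈ Finset.univ.erase i, spin σ j) ^ 2 + 1 - n) / 2)) *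
        Real.exp (spin σ i * (β * ((∑ j ∈ Finset.univ.erase i, spin σ j) / n))) := by
  rw [cwExponent_eq, ← Real.exp_add, ← Finset.add_sum_erase _ (spin σ) (Finset.mem_univ i)]
  congr 1
  have := spin_sq σ i
  generalize (∑ j ∈ Finset.univ.erase i, spin σ j) = s at *
  linear_combination (β / n / 2) * this

lemma glauber_detailed_balance (β : ℝ) {n : ℕ} (σ η : Config n) :
    cwMeasure β n σ * glauberKernel β n σ η = cwMeasure β n η * glauberKernel β n η σ := by
  unfold cwMeasure
  suffices h : Real.exp (cwExponent β σ) * glauberKernel β n σ η =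
      Real.exp (cwExponent β η) * glauberKernel β n η σ by
    rw [div_mul_eq_mul_div, h, div_mul_eq_mul_div]
  unfold glauberKernel
  rw [mul_left_comm, mul_left_comm (Real.exp (cwExponent β η))]
  refine congrArg ((1 / (n : ℝ)) * ·) ?_
  rw [Finset.mul_sum, Finset.mul_sum]
  refine Finset.sum_congr rfl fun i _ => ?_
  by_cases h : ∀ j, j ≠ i → η j = σ j
  · have h' : ∀ j, j ≠ i → σ j = η j := fun j hj => (h j hj).symm
    rw [if_pos h, if_pos h', exp_cwExponent_eq β σ i, exp_cwExponent_eq β η i,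
      mag_sub_spin_div, mag_sub_spin_div]
    have hs : ∑ j ∈ Finset.univ.erase i, spin η j = ∑ j ∈ Finset.univ.erase i, spin σ j := by
      refine Finset.sum_congr rfl fun j hj => ?_
      unfold spin
      rw [h j (Finset.ne_of_mem_erase hj)]
    rw [hs, mul_assoc, mul_assoc]
    congr 1
    have key := exp_mul_one_sub_pPlus β ((∑ j ∈ Finset.univ.erase i, spin σ j) / n)
    cases h1 : σ i <;> cases h2 : η i <;> simp [spin, h1, h2] at key ⊢ <;> linarith
  · have h' : ¬ ∀ j, j ≠ i → σ j = η j := fun h'' => h fun j hj => (h'' j hj).symm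
    rw [if_neg h, if_neg h', mul_zero, mul_zero]

lemma cwMeasure_stationary (β : ℝ) {n : ℕ} (hn : 0 < n) (η : Config n) :
    ∑ σ, cwMeasure β n σ * glauberKernel β n σ η = cwMeasure β n η := by
  simp_rw [glauber_detailed_balance β _ η]
  rw [← Finset.mul_sum, sum_glauberKernel β hn, mul_one]

/-! ### The restricted kernel and its stationary measure -/

lemma rKernel_nonneg (β : ℝ) {n : ℕ} (σ η : Config n) : 0 ≤ rKernel β n σ η := by
  have h1 := glauberKernel_nonneg β σ η
  have h2 := glauberKernel_nonneg β σ (negConfig η)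
  unfold rKernel
  split_ifs <;> linarith

lemma sum_rKernel_mul (β : ℝ) {n : ℕ} (σ : Config n) (g : Config n → ℝ)
    (hg : ∀ η, g (negConfig η) = g η) :
    ∑ η, rKernel β n σ η * g η = ∑ η, glauberKernel β n σ η * g η := by
  unfold rKernel
  simp only [add_mul, Finset.sum_add_distrib]
  have h : ∑ η, (if mag (negConfig η) < 0 then glauberKernel β n σ (negConfig η) else 0) * g η =
      ∑ η, (if mag η < 0 then glauberKernel β n σ η else 0) * g η := by
    rw [← sum_negConfig fun η => (if mag η < 0 then glauberKernel β n σ η else 0) * g η]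
    simp only [hg]
  rw [h, ← Finset.sum_add_distrib]
  refine Finset.sum_congr rfl fun η _ => ?_
  by_cases h0 : 0 ≤ mag η
  · simp [h0, h0.not_gt]
  · simp [h0, not_le.1 h0]

lemma sum_rKernel (β : ℝ) {n : ℕ} (hn : 0 < n) (σ : Config n) :
    ∑ η, rKernel β n σ η = 1 := by
  have h := sum_rKernel_mul β σ (fun _ => 1) fun _ => rfl
  simpa [sum_glauberKernel β hn] using h

lemma sum_muPlus_mul (β : ℝ) {n : ℕ} (g : Config n → ℝ) :
    ∑ η, muPlus β n η * g η =
      ∑ σ, cwMeasure β n σ * g (if 0 ≤ mag σ then σ else negConfig σ) := by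
  unfold muPlus
  simp only [Finset.sum_mul]
  rw [Finset.sum_comm]
  refine Finset.sum_congr rfl fun σ _ => ?_
  simp only [ite_mul, zero_mul]
  rw [Finset.sum_ite_eq]
  simp

lemma sum_muPlus_mul_of_even (β : ℝ) {n : ℕ} (g : Config n → ℝ)
    (hg : ∀ η, g (negConfig η) = g η) :
    ∑ η, muPlus β n η * g η = ∑ σ, cwMeasure β n σ * g σ := by
  rw [sum_muPlus_mul]
  refine Finset.sum_congr rfl fun σ _ => ?_
  split_ifs
  · rfl
  · rw [hg]

lemma sum_muPlus (β : ℝ) (n : ℕ) : ∑ η, muPlus β n η = 1 := by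
  have h := sum_muPlus_mul_of_even β (n := n) (fun _ => 1) fun _ => rfl
  simpa [sum_cwMeasure] using h

/-- A configuration of zero magnetization is mapped to its negative by a permutation of sites. -/
lemma exists_comp_eq_negConfig {n : ℕ} {η : Config n} (h : mag η = 0) :
    ∃ e : Equiv.Perm (Fin n), η ∘ e = negConfig η := by
  classical
  have hsum : ∑ i, spin η i = 0 := by
    rcases Nat.eq_zero_or_pos n with rfl | hn
    · simp
    · unfold mag at h
      have hn' : (n : ℝ) ≠ 0 := by positivity
      simpa [hn'] using h
  have hcard : Fintype.card {i // η i = true} = Fintype.card {i // ¬ η i = true} := by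
    rw [Fintype.card_subtype, Fintype.card_subtype]
    unfold spin at hsum
    rw [Finset.sum_ite] at hsum
    simp only [Finset.sum_const, nsmul_eq_mul, mul_one, mul_neg] at hsum
    have : ((Finset.univ.filter fun i => η i = true).card : ℝ) =
        (Finset.univ.filter fun i => ¬ η i = true).card := by linarith
    exact_mod_cast this
  let e1 : {i // η i = true} ≃ {i // ¬ η i = true} := Fintype.equivOfCardEq hcard
  refine ⟨e1.extendSubtype, ?_⟩
  funext i
  by_cases hi : η i = true
  · have := e1.extendSubtype_mem i hi
    simp [negConfig, hi, this]
  · have := e1.extendSubtype_not_mem i hi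
    simp only [not_not] at this
    simp [negConfig, hi, this]

lemma rKernel_of_mag_pos (β : ℝ) {n : ℕ} (σ : Config n) {η : Config n} (h : 0 < mag η) :
    rKernel β n σ η = glauberKernel β n σ η + glauberKernel β n σ (negConfig η) := by
  have h2 : mag (negConfig η) < 0 := by rw [mag_negConfig]; linarith
  simp [rKernel, h.le, h2]

lemma rKernel_of_mag_zero (β : ℝ) {n : ℕ} (σ : Config n) {η : Config n} (h : mag η = 0) :
    rKernel β n σ η = glauberKernel β n σ η := by
  simp [rKernel, mag_negConfig, h]

lemma rKernel_of_mag_neg (β : ℝ) {n : ℕ} (σ : Config n) {η : Config n} (h : mag η < 0) :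
    rKernel β n σ η = 0 := by
  have h2 : ¬ mag (negConfig η) < 0 := by rw [mag_negConfig]; linarith
  simp [rKernel, h, h2]

lemma muPlus_of_mag_pos (β : ℝ) {n : ℕ} {η : Config n} (h : 0 < mag η) :
    muPlus β n η = cwMeasure β n η + cwMeasure β n (negConfig η) := by
  have h2 : mag (negConfig η) < 0 := by rw [mag_negConfig]; linarith
  have h3 : η ≠ negConfig η := fun h' => by rw [← h'] at h2; linarith
  have h4 : ∀ σ : Config n, (if (if 0 ≤ mag σ then σ else negConfig σ) = η
      then cwMeasure β n σ else 0) = (if σ = η then cwMeasure β n σ else 0) +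
        (if σ = negConfig η then cwMeasure β n σ else 0) := by
    intro σ
    by_cases h1 : σ = η
    · subst h1
      simp [h.le, h3]
    · by_cases h5 : σ = negConfig η
      · subst h5
        simp [h2, h3.symm, negConfig_negConfig]
      · rw [if_neg h1, if_neg h5, if_neg, add_zero]
        split_ifs
        · exact h1
        · rwa [negConfig_eq_iff]
  unfold muPlus
  simp only [h4, Finset.sum_add_distrib, Finset.sum_ite_eq', Finset.mem_univ, if_true]

lemma muPlus_of_mag_zero (β : ℝ) {n : ℕ} {η : Config n} (h : mag η = 0) :
    muPlus β n η = cwMeasure β n η := by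
  have h4 : ∀ σ : Config n, (if (if 0 ≤ mag σ then σ else negConfig σ) = η
      then cwMeasure β n σ else 0) = (if σ = η then cwMeasure β n σ else 0) := by
    intro σ
    refine if_congr ?_ rfl rfl
    split_ifs with h0
    · rfl
    · rw [negConfig_eq_iff]
      constructor
      · rintro rfl
        simp [mag_negConfig, h] at h0
      · rintro rfl
        simp [h] at h0
  unfold muPlus
  simp only [h4, Finset.sum_ite_eq', Finset.mem_univ, if_true]

lemma muPlus_of_mag_neg (β : ℝ) {n : ℕ} {η : Config n} (h : mag η < 0) :
    muPlus β n η = 0 := by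
  unfold muPlus
  refine Finset.sum_eq_zero fun σ _ => if_neg ?_
  split_ifs with h0
  · rintro rfl
    linarith
  · rintro rfl
    rw [mag_negConfig] at h
    linarith

lemma muPlus_stationary (β : ℝ) {n : ℕ} (hn : 0 < n) (η : Config n) :
    ∑ σ, muPlus β n σ * rKernel β n σ η = muPlus β n η := by
  rw [sum_muPlus_mul β fun σ => rKernel β n σ η]
  rcases lt_trichotomy (mag η) 0 with h | h | h
  · rw [muPlus_of_mag_neg β h]
    exact Finset.sum_eq_zero fun σ _ => by rw [rKernel_of_mag_neg β _ h, mul_zero]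
  · rw [muPlus_of_mag_zero β h, ← cwMeasure_stationary β hn η]
    obtain ⟨e, he⟩ := exists_comp_eq_negConfig h
    have hflip : ∑ σ, (if 0 ≤ mag σ then 0 else
          cwMeasure β n σ * glauberKernel β n σ (negConfig η)) =
        ∑ σ, if 0 ≤ mag σ then 0 else cwMeasure β n σ * glauberKernel β n σ η := by
      refine (Fintype.sum_equiv (Equiv.arrowCongr e.symm (Equiv.refl Bool)) _ _ fun σ => ?_).symm
      have : (Equiv.arrowCongr e.symm (Equiv.refl Bool)) σ = σ ∘ e := by
        funext i; simp
      rw [this, mag_comp, cwMeasure_comp, ← he, glauberKernel_comp]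
    have hsplit : ∀ τ : Config n, ∑ σ, cwMeasure β n σ * glauberKernel β n σ τ =
        ∑ σ, (if 0 ≤ mag σ then cwMeasure β n σ * glauberKernel β n σ τ else 0) +
        ∑ σ, (if 0 ≤ mag σ then 0 else cwMeasure β n σ * glauberKernel β n σ τ) := by
      intro τ
      rw [← Finset.sum_add_distrib]
      refine Finset.sum_congr rfl fun σ _ => ?_
      split_ifs <;> simp
    rw [hsplit, ← hflip, ← Finset.sum_add_distrib]
    refine Finset.sum_congr rfl fun σ _ => ?_
    rw [rKernel_of_mag_zero β _ h]
    split_ifs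
    · simp
    · rw [← glauberKernel_negConfig, negConfig_negConfig, zero_add]
  · rw [muPlus_of_mag_pos β h, ← cwMeasure_stationary β hn η,
      ← cwMeasure_stationary β hn (negConfig η), ← Finset.sum_add_distrib]
    refine Finset.sum_congr rfl fun σ _ => ?_
    rw [rKernel_of_mag_pos β _ h, ← mul_add]
    congr 1
    split_ifs
    · rfl
    · rw [← glauberKernel_negConfig, ← glauberKernel_negConfig β (negConfig σ) (negConfig η),
        negConfig_negConfig, negConfig_negConfig, add_comm]

/-! ### Convergence of a finite chain with an accessible state -/

/-- A finite stochastic matrix, one of whose powers has an entrywise positive column, converges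
to its stationary distribution. -/
lemma exists_tvDist_pow_le {Ω : Type*} [Fintype Ω] [DecidableEq Ω] [Nonempty Ω]
    (K : Matrix Ω Ω ℝ) (hK0 : ∀ x y, 0 ≤ K x y) (hK1 : ∀ x, ∑ y, K x y = 1)
    (ν : Ω → ℝ) (hν1 : ∑ x, ν x = 1) (hν : ∀ y, ∑ x, ν x * K x y = ν y)
    (x₀ : Ω) (m : ℕ) (hpos : ∀ x, 0 < (K ^ m) x x₀) {ε : ℝ} (hε : 0 < ε) :
    ∃ t : ℕ, ∀ x, tvDist ((K ^ t) x) ν ≤ ε := by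
  have hpow0 : ∀ t x y, 0 ≤ (K ^ t) x y := by
    intro t
    induction t with
    | zero =>
      intro x y
      rw [pow_zero, Matrix.one_apply]
      split_ifs <;> norm_num
    | succ t ih =>
      intro x y
      rw [pow_succ, Matrix.mul_apply]
      exact Finset.sum_nonneg fun z _ => mul_nonneg (ih x z) (hK0 z y)
  have hpow1 : ∀ t x, ∑ y, (K ^ t) x y = 1 := by
    intro t
    induction t with
    | zero => intro x; simp [Matrix.one_apply]
    | succ t ih =>
      intro x
      simp only [pow_succ, Matrix.mul_apply]
      rw [Finset.sum_comm]
      simp only [← Finset.mul_sum, hK1, mul_one, ih]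
  have hpowν : ∀ t y, ∑ x, ν x * (K ^ t) x y = ν y := by
    intro t
    induction t with
    | zero => intro y; simp [Matrix.one_apply]
    | succ t ih =>
      intro y
      simp only [pow_succ, Matrix.mul_apply, Finset.mul_sum]
      rw [Finset.sum_comm]
      simp only [← mul_assoc, ← Finset.sum_mul, ih, hν]
  obtain ⟨x₁, hx₁⟩ := Finite.exists_min fun x => (K ^ m) x x₀
  set δ := (K ^ m) x₁ x₀ with hδ
  have hδ0 : 0 < δ := hpos x₁
  have hδ1 : δ ≤ 1 := by
    rw [← hpow1 m x₁]
    exact Finset.single_le_sum (fun y _ => hpow0 m x₁ y) (Finset.mem_univ x₀)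
  have hcontr : ∀ u : Ω → ℝ, ∑ x, u x = 0 →
      ∑ y, |∑ x, u x * (K ^ m) x y| ≤ (1 - δ) * ∑ x, |u x| := by
    intro u hu
    have h1 : ∀ y, ∑ x, u x * (K ^ m) x y =
        ∑ x, u x * ((K ^ m) x y - if y = x₀ then δ else 0) := by
      intro y
      simp only [mul_sub, Finset.sum_sub_distrib, ← Finset.sum_mul, hu, zero_mul, sub_zero]
    have h2 : ∀ x y, 0 ≤ (K ^ m) x y - if y = x₀ then δ else 0 := by
      intro x y
      split_ifs with h
      · rw [h, sub_nonneg]; exact hx₁ x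
      · rw [sub_zero]; exact hpow0 m x y
    calc ∑ y, |∑ x, u x * (K ^ m) x y|
        ≤ ∑ y, ∑ x, |u x| * ((K ^ m) x y - if y = x₀ then δ else 0) := by
          refine Finset.sum_le_sum fun y _ => ?_
          rw [h1]
          refine (Finset.abs_sum_le_sum_abs _ _).trans (le_of_eq ?_)
          refine Finset.sum_congr rfl fun x _ => ?_
          rw [abs_mul, abs_of_nonneg (h2 x y)]
      _ = (1 - δ) * ∑ x, |u x| := by
          rw [Finset.sum_comm, Finset.mul_sum]
          refine Finset.sum_congr rfl fun x _ => ?_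
          rw [← Finset.mul_sum, Finset.sum_sub_distrib, hpow1]
          simp [mul_comm]
  have hiter : ∀ k x, ∑ y, |(K ^ (m * k)) x y - ν y| ≤ (1 - δ) ^ k * (1 + ∑ y, |ν y|) := by
    intro k
    induction k with
    | zero =>
      intro x
      rw [Nat.mul_zero, pow_zero, pow_zero, one_mul]
      calc ∑ y, |(1 : Matrix Ω Ω ℝ) x y - ν y|
          ≤ ∑ y, (|(1 : Matrix Ω Ω ℝ) x y| + |ν y|) :=
            Finset.sum_le_sum fun y _ => abs_sub _ _
        _ = 1 + ∑ y, |ν y| := by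
            rw [Finset.sum_add_distrib]
            congr 1
            simp [Matrix.one_apply, apply_ite]
    | succ k ih =>
      intro x
      have h := hcontr (fun y => (K ^ (m * k)) x y - ν y) (by
        rw [Finset.sum_sub_distrib, hpow1, hν1, sub_self])
      have h' : ∀ y, (K ^ (m * (k + 1))) x y - ν y =
          ∑ z, ((K ^ (m * k)) x z - ν z) * (K ^ m) z y := by
        intro y
        simp only [sub_mul, Finset.sum_sub_distrib, hpowν]
        rw [mul_add, mul_one, pow_add, Matrix.mul_apply]
      simp only [h']
      refine h.trans ?_
      rw [pow_succ' (1 - δ), mul_assoc]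
      exact mul_le_mul_of_nonneg_left (ih x) (by linarith)
  have hC : 0 < 1 + ∑ y, |ν y| := by
    have : 0 ≤ ∑ y, |ν y| := Finset.sum_nonneg fun _ _ => abs_nonneg _
    linarith
  obtain ⟨k, hk⟩ := exists_pow_lt_of_lt_one (div_pos hε hC) (by linarith : 1 - δ < 1)
  refine ⟨m * k, fun x => ?_⟩
  have h1 := hiter k x
  rw [lt_div_iff₀ hC] at hk
  have h0 : 0 ≤ ∑ y, |(K ^ (m * k)) x y - ν y| := Finset.sum_nonneg fun _ _ => abs_nonneg _
  unfold tvDist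
  linarith

/-! ### The restricted dynamics converges -/

lemma rLaw_eq_pow (β : ℝ) (n t : ℕ) (σ η : Config n) :
    rLaw β n t σ η = ((Matrix.of (rKernel β n)) ^ t) σ η := by
  induction t generalizing η with
  | zero => simp [rLaw, Matrix.one_apply, eq_comm]
  | succ t ih =>
    rw [pow_succ, Matrix.mul_apply]
    simp only [rLaw, ih, Matrix.of_apply]

lemma rLaw_nonneg (β : ℝ) (n t : ℕ) (σ η : Config n) : 0 ≤ rLaw β n t σ η := by
  induction t generalizing η with
  | zero => simp only [rLaw]; split_ifs <;> norm_num
  | succ t ih => exact Finset.sum_nonneg fun τ _ => mul_nonneg (ih τ) (rKernel_nonneg β τ η)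

lemma rLaw_succ_pos (β : ℝ) {n t : ℕ} {σ τ η : Config n} (h1 : 0 < rLaw β n t σ τ)
    (h2 : 0 < rKernel β n τ η) : 0 < rLaw β n (t + 1) σ η :=
  Finset.sum_pos' (fun ξ _ => mul_nonneg (rLaw_nonneg β n t σ ξ) (rKernel_nonneg β ξ η))
    ⟨τ, Finset.mem_univ _, mul_pos h1 h2⟩

lemma rKernel_pos_of_glauberKernel_pos (β : ℝ) {n : ℕ} {σ η : Config n} (h0 : 0 ≤ mag η)
    (h : 0 < glauberKernel β n σ η) : 0 < rKernel β n σ η := by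
  have := glauberKernel_nonneg β σ (negConfig η)
  simp only [rKernel, if_pos h0]
  split_ifs <;> linarith

lemma mag_le_mag {n : ℕ} {σ η : Config n} (h : ∀ i, σ i = true → η i = true) :
    mag σ ≤ mag η := by
  unfold mag
  gcongr with i
  have := h i
  unfold spin
  cases h1 : σ i <;> cases h2 : η i <;> simp_all

lemma rLaw_one_add_card_pos (β : ℝ) {n : ℕ} (hn : 0 < n) (σ : Config n) :
    ∃ τ : Config n, 0 ≤ mag τ ∧ ∀ s : Finset (Fin n),
      0 < rLaw β n (1 + s.card) σ fun i => if i ∈ s then true else τ i := by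
  have hKσ : 0 < glauberKernel β n σ σ := glauberKernel_pos β σ σ ⟨0, hn⟩ fun _ _ => rfl
  have h0 : 0 < rLaw β n 0 σ σ := by simp [rLaw]
  obtain ⟨τ, hτ, h1⟩ : ∃ τ : Config n, 0 ≤ mag τ ∧ 0 < rLaw β n 1 σ τ := by
    by_cases hσ : 0 ≤ mag σ
    · exact ⟨σ, hσ, rLaw_succ_pos β h0 (rKernel_pos_of_glauberKernel_pos β hσ hKσ)⟩
    · have hσ' : 0 < mag (negConfig σ) := by rw [mag_negConfig]; linarith
      refine ⟨negConfig σ, hσ'.le, rLaw_succ_pos β h0 ?_⟩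
      rw [rKernel_of_mag_pos β σ hσ', negConfig_negConfig]
      have := glauberKernel_nonneg β σ (negConfig σ)
      linarith
  refine ⟨τ, hτ, fun s => ?_⟩
  induction s using Finset.induction_on with
  | empty => simpa using h1
  | insert a s ha ih =>
    rw [Finset.card_insert_of_notMem ha, ← add_assoc]
    refine rLaw_succ_pos β ih (rKernel_pos_of_glauberKernel_pos β ?_ ?_)
    · refine hτ.trans (mag_le_mag fun i hi => ?_)
      simp [hi]
    · refine glauberKernel_pos β _ _ a fun j hj => ?_
      simp [Finset.mem_insert, hj]

lemma exists_rDist_le (β : ℝ) {n : ℕ} (hn : 0 < n) : ∃ t, rDist β n t ≤ 1 / 4 := by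
  have hpos : ∀ σ : Config n, 0 < ((Matrix.of (rKernel β n)) ^ (1 + n)) σ fun _ => true := by
    intro σ
    obtain ⟨τ, -, h⟩ := rLaw_one_add_card_pos β hn σ
    simpa [← rLaw_eq_pow] using h Finset.univ
  obtain ⟨t, ht⟩ := exists_tvDist_pow_le (Matrix.of (rKernel β n)) (rKernel_nonneg β)
    (sum_rKernel β hn) (muPlus β n) (sum_muPlus β n) (muPlus_stationary β hn) _ _ hpos
    (by norm_num : (0 : ℝ) < 1 / 4)
  refine ⟨t, Real.iSup_le (fun σ => ?_) (by norm_num)⟩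
  have h : rLaw β n t σ.1 = ((Matrix.of (rKernel β n)) ^ t) σ.1 := by
    funext η
    exact rLaw_eq_pow β n t σ.1 η
  rw [h]
  exact ht σ.1

/-! ### Drift of a balanced linear statistic -/

/-- The overlap `∑ᵢ a(i) σ(i)` of a configuration with a weight vector. -/
def overlap {n : ℕ} (a : Fin n → ℝ) (σ : Config n) : ℝ := ∑ i, a i * spin σ i

lemma overlap_negConfig {n : ℕ} (a : Fin n → ℝ) (σ : Config n) :
    overlap a (negConfig σ) = -overlap a σ := by
  simp [overlap, spin_negConfig]

lemma overlap_update {n : ℕ} (a : Fin n → ℝ) (σ : Config n) (i : Fin n) (b : Bool) :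
    overlap a (Function.update σ i b) =
      overlap a σ + a i * ((if b then 1 else -1) - spin σ i) := by
  unfold overlap
  rw [← Finset.add_sum_erase _ _ (Finset.mem_univ i),
    ← Finset.add_sum_erase _ (fun j => a j * spin σ j) (Finset.mem_univ i)]
  have h : ∑ j ∈ Finset.univ.erase i, a j * spin (Function.update σ i b) j =
      ∑ j ∈ Finset.univ.erase i, a j * spin σ j := by
    refine Finset.sum_congr rfl fun j hj => ?_
    simp [spin, Finset.ne_of_mem_erase hj]
  rw [h]
  simp only [spin, Function.update_self]
  ring

lemma abs_overlap_le {n : ℕ} {a : Fin n → ℝ} (ha : ∀ i, |a i| ≤ 1) (σ : Config n) :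
    |overlap a σ| ≤ n := by
  unfold overlap
  calc |∑ i, a i * spin σ i| ≤ ∑ i, |a i * spin σ i| := Finset.abs_sum_le_sum_abs _ _
    _ ≤ ∑ _i : Fin n, (1 : ℝ) := by
        refine Finset.sum_le_sum fun i _ => ?_
        rw [abs_mul]
        have : |spin σ i| = 1 := by unfold spin; split_ifs <;> simp
        rw [this, mul_one]
        exact ha i
    _ = n := by simp

lemma overlap_drift {β : ℝ} (hβ : 0 ≤ β) {n : ℕ} (hn : 0 < n) {a : Fin n → ℝ}
    (ha : ∀ i, |a i| ≤ 1) (hsum : ∑ i, a i = 0) (σ : Config n) :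
    ∃ c : ℝ, -(β / n) ≤ c ∧ c ≤ 0 ∧
      ∑ η, glauberKernel β n σ η * overlap a η = overlap a σ * (1 - 1 / n + c / n) ∧
      ∑ η, glauberKernel β n σ η * overlap a η ^ 2 ≤
        overlap a σ ^ 2 * (1 - 2 / n + 2 * c / n) + 4 := by
  have hn' : (0 : ℝ) < n := Nat.cast_pos.2 hn
  set x := β * (mag σ - 1 / n) with hx
  set y := β * (mag σ + 1 / n) with hy
  have hxy : x ≤ y := by
    have : 0 ≤ β * (1 / n) := by positivity
    rw [hx, hy]
    linarith
  have hyx : y - x = 2 * (β / n) := by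
    rw [hx, hy]
    ring
  have hmono := tanh_monotone hxy
  have hlip := tanh_sub_tanh_le hxy
  set c₀ := (Real.tanh x + Real.tanh y) / 2 with hc₀
  set c := (Real.tanh x - Real.tanh y) / 2 with hc
  have hp : ∀ i, pPlus β (mag σ - spin σ i / n) = (1 + (c₀ + c * spin σ i)) / 2 := by
    intro i
    unfold pPlus
    congr 2
    unfold spin
    split_ifs
    · rw [← hx, hc₀, hc]
      ring
    · rw [neg_div, sub_neg_eq_add, ← hy, hc₀, hc]
      ring
  have hlin : ∑ i, a i * ((c₀ + c * spin σ i) - spin σ i) = (c - 1) * overlap a σ := by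
    calc ∑ i, a i * ((c₀ + c * spin σ i) - spin σ i)
        = ∑ i, (c₀ * a i + (c - 1) * (a i * spin σ i)) :=
          Finset.sum_congr rfl fun i _ => by ring
      _ = (c - 1) * overlap a σ := by
          rw [Finset.sum_add_distrib, ← Finset.mul_sum, ← Finset.mul_sum, hsum, mul_zero, zero_add]
          rfl
  refine ⟨c, by linarith, by linarith, ?_, ?_⟩
  · rw [sum_glauberKernel_mul]
    have h : ∀ i, pPlus β (mag σ - spin σ i / n) * overlap a (Function.update σ i true) +
        (1 - pPlus β (mag σ - spin σ i / n)) * overlap a (Function.update σ i false) =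
        overlap a σ + a i * ((c₀ + c * spin σ i) - spin σ i) := by
      intro i
      rw [overlap_update, overlap_update, hp]
      simp only [if_true, Bool.false_eq_true, if_false]
      ring
    simp only [h, Finset.sum_add_distrib, hlin, Finset.sum_const, Finset.card_univ,
      Fintype.card_fin, nsmul_eq_mul]
    field_simp
    ring
  · rw [sum_glauberKernel_mul]
    have h : ∀ i, pPlus β (mag σ - spin σ i / n) * overlap a (Function.update σ i true) ^ 2 +
        (1 - pPlus β (mag σ - spin σ i / n)) * overlap a (Function.update σ i false) ^ 2 ≤
        overlap a σ ^ 2 + 2 * overlap a σ * (a i * ((c₀ + c * spin σ i) - spin σ i)) + 4 := by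
      intro i
      have h0 := pPlus_pos β (mag σ - spin σ i / n)
      have h1 := pPlus_lt_one β (mag σ - spin σ i / n)
      have h2 : a i ^ 2 ≤ 1 := (sq_le_one_iff_abs_le_one _).2 (ha i)
      have hT : c₀ + c * spin σ i = 2 * pPlus β (mag σ - spin σ i / n) - 1 := by
        rw [hp]
        ring
      rw [overlap_update, overlap_update, hT]
      simp only [if_true, Bool.false_eq_true, if_false]
      generalize pPlus β (mag σ - spin σ i / n) = p at *
      have hv : p * (1 - spin σ i) ^ 2 + (1 - p) * (-1 - spin σ i) ^ 2 ≤ 4 := by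
        unfold spin
        split_ifs <;> nlinarith
      have hv0 : 0 ≤ p * (1 - spin σ i) ^ 2 + (1 - p) * (-1 - spin σ i) ^ 2 := by
        have : 0 ≤ 1 - p := by linarith
        positivity
      have := mul_le_mul h2 hv hv0 zero_le_one
      linarith
    refine (mul_le_mul_of_nonneg_left (Finset.sum_le_sum fun i _ => h i)
      (by positivity)).trans (le_of_eq ?_)
    simp only [Finset.sum_add_distrib, ← Finset.mul_sum, hlin, Finset.sum_const, Finset.card_univ,
      Fintype.card_fin, nsmul_eq_mul]
    field_simp
    ring

lemma sum_cwMeasure_mul_overlap_sq_le {β : ℝ} (hβ : 0 ≤ β) {n : ℕ} (hn : 0 < n) {a : Fin n → ℝ}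
    (ha : ∀ i, |a i| ≤ 1) (hsum : ∑ i, a i = 0) :
    ∑ σ, cwMeasure β n σ * overlap a σ ^ 2 ≤ 2 * n := by
  have hn' : (0 : ℝ) < n := Nat.cast_pos.2 hn
  have hstat : ∑ σ, cwMeasure β n σ * overlap a σ ^ 2 =
      ∑ σ, cwMeasure β n σ * ∑ η, glauberKernel β n σ η * overlap a η ^ 2 := by
    simp only [Finset.mul_sum]
    rw [Finset.sum_comm]
    refine Finset.sum_congr rfl fun η _ => ?_
    rw [← cwMeasure_stationary β hn η, Finset.sum_mul]
    exact Finset.sum_congr rfl fun σ _ => by ring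
  have hle : ∑ σ, cwMeasure β n σ * overlap a σ ^ 2 ≤
      ∑ σ, cwMeasure β n σ * ((1 - 2 / n) * overlap a σ ^ 2 + 4) := by
    rw [hstat]
    refine Finset.sum_le_sum fun σ _ => mul_le_mul_of_nonneg_left ?_ (cwMeasure_nonneg β σ)
    obtain ⟨c, -, hc, -, h⟩ := overlap_drift hβ hn ha hsum σ
    have h1 : overlap a σ ^ 2 * (2 * c / n) ≤ 0 :=
      mul_nonpos_of_nonneg_of_nonpos (sq_nonneg _)
        (div_nonpos_of_nonpos_of_nonneg (by linarith) hn'.le)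
    linarith
  have heq : ∑ σ, cwMeasure β n σ * ((1 - 2 / n) * overlap a σ ^ 2 + 4) =
      (1 - 2 / n) * ∑ σ, cwMeasure β n σ * overlap a σ ^ 2 + 4 := by
    have : ∀ σ : Config n, cwMeasure β n σ * ((1 - 2 / n) * overlap a σ ^ 2 + 4) =
        (1 - 2 / n) * (cwMeasure β n σ * overlap a σ ^ 2) + cwMeasure β n σ * 4 :=
      fun σ => by ring
    simp only [this, Finset.sum_add_distrib, ← Finset.mul_sum, ← Finset.sum_mul, sum_cwMeasure,
      one_mul]
  rw [heq] at hle
  generalize ∑ σ, cwMeasure β n σ * overlap a σ ^ 2 = z at hle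
  have h2 : 2 / (n : ℝ) * z ≤ 4 := by linarith
  rw [div_mul_eq_mul_div, div_le_iff₀ hn'] at h2
  linarith

/-! ### Moments along the Glauber dynamics -/

lemma sum_glauberLaw_succ_mul (β : ℝ) {n : ℕ} (t : ℕ) (σ : Config n) (g : Config n → ℝ) :
    ∑ η, glauberLaw β n (t + 1) σ η * g η =
      ∑ τ, glauberLaw β n t σ τ * ∑ η, glauberKernel β n τ η * g η := by
  simp only [glauberLaw, Finset.sum_mul, Finset.mul_sum, mul_assoc]
  rw [Finset.sum_comm]

lemma glauberLaw_nonneg (β : ℝ) {n : ℕ} (t : ℕ) (σ η : Config n) : 0 ≤ glauberLaw β n t σ η := by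
  induction t generalizing η with
  | zero => simp only [glauberLaw]; split_ifs <;> norm_num
  | succ t ih => exact Finset.sum_nonneg fun τ _ => mul_nonneg (ih τ) (glauberKernel_nonneg β τ η)

lemma sum_glauberLaw (β : ℝ) {n : ℕ} (hn : 0 < n) (t : ℕ) (σ : Config n) :
    ∑ η, glauberLaw β n t σ η = 1 := by
  induction t with
  | zero => simp [glauberLaw]
  | succ t ih =>
    have h := sum_glauberLaw_succ_mul β t σ fun _ => 1
    simpa [sum_glauberKernel β hn, ih] using h

lemma sum_rLaw_mul (β : ℝ) {n : ℕ} (t : ℕ) (σ : Config n) (g : Config n → ℝ)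
    (hg : ∀ η, g (negConfig η) = g η) :
    ∑ η, rLaw β n t σ η * g η = ∑ η, glauberLaw β n t σ η * g η := by
  induction t generalizing g with
  | zero => rfl
  | succ t ih =>
    have hr : ∑ η, rLaw β n (t + 1) σ η * g η =
        ∑ τ, rLaw β n t σ τ * ∑ η, rKernel β n τ η * g η := by
      simp only [rLaw, Finset.sum_mul, Finset.mul_sum, mul_assoc]
      rw [Finset.sum_comm]
    rw [hr, sum_glauberLaw_succ_mul]
    simp only [sum_rKernel_mul β _ g hg]
    refine ih _ fun τ => ?_
    rw [← sum_negConfig fun η => glauberKernel β n (negConfig τ) η * g η]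
    simp only [glauberKernel_negConfig, hg]

lemma sum_rLaw (β : ℝ) {n : ℕ} (hn : 0 < n) (t : ℕ) (σ : Config n) :
    ∑ η, rLaw β n t σ η = 1 := by
  have h := sum_rLaw_mul β t σ (fun _ => 1) fun _ => rfl
  simpa [sum_glauberLaw β hn] using h

lemma le_sum_glauberLaw_mul_overlap {β : ℝ} (hβ : 0 ≤ β) {n : ℕ} (hn : 0 < n) {a : Fin n → ℝ}
    (ha : ∀ i, |a i| ≤ 1) (hsum : ∑ i, a i = 0) (σ : Config n) (t : ℕ) :
    (1 - 1 / n) ^ t * overlap a σ - β ≤ ∑ η, glauberLaw β n t σ η * overlap a η := by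
  have hn' : (0 : ℝ) < n := Nat.cast_pos.2 hn
  have hr : 0 ≤ 1 - 1 / (n : ℝ) := by
    rw [sub_nonneg]
    exact div_le_one_of_le₀ (by exact_mod_cast hn) hn'.le
  induction t with
  | zero => simpa [glauberLaw] using hβ
  | succ t ih =>
    rw [sum_glauberLaw_succ_mul]
    have hstep : ∀ τ : Config n, (1 - 1 / n) * overlap a τ - β / n ≤
        ∑ η, glauberKernel β n τ η * overlap a η := by
      intro τ
      obtain ⟨c, hc1, hc2, h, -⟩ := overlap_drift hβ hn ha hsum τ
      have hb : |overlap a τ * (c / n)| ≤ β / n := by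
        rw [abs_mul, abs_div, abs_of_nonpos hc2, abs_of_pos hn']
        calc |overlap a τ| * (-c / n) ≤ n * (β / n / n) := by
              gcongr
              · exact div_nonneg (by linarith) hn'.le
              · exact abs_overlap_le ha τ
              · linarith
          _ = β / n := by field_simp
      have := (abs_le.1 hb).1
      rw [h]
      linarith
    calc (1 - 1 / n) ^ (t + 1) * overlap a σ - β
        = (1 - 1 / n) * ((1 - 1 / n) ^ t * overlap a σ - β) - β / n := by ring
      _ ≤ (1 - 1 / n) * (∑ η, glauberLaw β n t σ η * overlap a η) - β / n := by gcongr
      _ = ∑ τ, glauberLaw β n t σ τ * ((1 - 1 / n) * overlap a τ - β / n) := by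
          simp only [mul_sub, Finset.sum_sub_distrib, ← Finset.sum_mul, sum_glauberLaw β hn,
            one_mul, Finset.mul_sum]
          congr 1
          exact Finset.sum_congr rfl fun τ _ => by ring
      _ ≤ _ := Finset.sum_le_sum fun τ _ =>
          mul_le_mul_of_nonneg_left (hstep τ) (glauberLaw_nonneg β t σ τ)

lemma sum_glauberLaw_mul_overlap_sq_le {β : ℝ} (hβ : 0 ≤ β) {n : ℕ} (hn : 0 < n)
    {a : Fin n → ℝ} (ha : ∀ i, |a i| ≤ 1) (hsum : ∑ i, a i = 0) (σ : Config n) (t : ℕ) :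
    ∑ η, glauberLaw β n t σ η * overlap a η ^ 2 ≤
      ((1 - 1 / n) ^ t * overlap a σ) ^ 2 + 4 * n := by
  have hn' : (0 : ℝ) < n := Nat.cast_pos.2 hn
  have hr : 0 ≤ 1 - 1 / (n : ℝ) := by
    rw [sub_nonneg]
    exact div_le_one_of_le₀ (by exact_mod_cast hn) hn'.le
  have hr1 : 1 - 1 / (n : ℝ) ≤ 1 := by
    have : 0 ≤ 1 / (n : ℝ) := by positivity
    linarith
  induction t with
  | zero => simp [glauberLaw]
  | succ t ih =>
    rw [sum_glauberLaw_succ_mul]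
    have hstep : ∀ τ : Config n, ∑ η, glauberKernel β n τ η * overlap a η ^ 2 ≤
        (1 - 1 / n) ^ 2 * overlap a τ ^ 2 + 4 := by
      intro τ
      obtain ⟨c, -, hc, -, h⟩ := overlap_drift hβ hn ha hsum τ
      have h1 : overlap a τ ^ 2 * (2 * c / n) ≤ 0 :=
        mul_nonpos_of_nonneg_of_nonpos (sq_nonneg _)
          (div_nonpos_of_nonpos_of_nonneg (by linarith) hn'.le)
      have h2 : 0 ≤ overlap a τ ^ 2 * (1 / (n : ℝ)) ^ 2 := by positivity
      have h3 : (1 - 1 / (n : ℝ)) ^ 2 * overlap a τ ^ 2 =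
          overlap a τ ^ 2 * (1 - 2 / n) + overlap a τ ^ 2 * (1 / (n : ℝ)) ^ 2 := by ring
      linarith
    calc ∑ τ, glauberLaw β n t σ τ * ∑ η, glauberKernel β n τ η * overlap a η ^ 2
        ≤ ∑ τ, glauberLaw β n t σ τ * ((1 - 1 / n) ^ 2 * overlap a τ ^ 2 + 4) :=
          Finset.sum_le_sum fun τ _ =>
            mul_le_mul_of_nonneg_left (hstep τ) (glauberLaw_nonneg β t σ τ)
      _ = (1 - 1 / n) ^ 2 * (∑ τ, glauberLaw β n t σ τ * overlap a τ ^ 2) + 4 := by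
          simp only [mul_add, Finset.sum_add_distrib, ← Finset.sum_mul, sum_glauberLaw β hn,
            one_mul, Finset.mul_sum]
          congr 1
          exact Finset.sum_congr rfl fun τ _ => by ring
      _ ≤ (1 - 1 / n) ^ 2 * (((1 - 1 / n) ^ t * overlap a σ) ^ 2 + 4 * n) + 4 := by gcongr
      _ = ((1 - 1 / n) ^ (t + 1) * overlap a σ) ^ 2 + ((1 - 1 / n) ^ 2 * (4 * n) + 4) := by ring
      _ ≤ ((1 - 1 / n) ^ (t + 1) * overlap a σ) ^ 2 + ((1 - 1 / n) * (4 * n) + 4) := by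
          gcongr
          exact pow_le_of_le_one hr hr1 two_ne_zero
      _ = ((1 - 1 / n) ^ (t + 1) * overlap a σ) ^ 2 + 4 * n := by
          field_simp
          ring

/-! ### Lower bound on the distance to stationarity -/

lemma sum_sub_mul_le_tvDist {Ω : Type*} [Fintype Ω] {p q g : Ω → ℝ} (hp : ∑ x, p x = 1)
    (hq : ∑ x, q x = 1) (hg0 : ∀ x, 0 ≤ g x) (hg1 : ∀ x, g x ≤ 1) :
    ∑ x, q x * g x - ∑ x, p x * g x ≤ tvDist p q := by
  have h : ∑ x, q x * g x - ∑ x, p x * g x = ∑ x, (q x - p x) * (g x - 1 / 2) := by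
    simp only [sub_mul, mul_sub, Finset.sum_sub_distrib, ← Finset.sum_mul, hp, hq]
    ring
  rw [h]
  unfold tvDist
  rw [Finset.sum_div]
  refine Finset.sum_le_sum fun x _ => ?_
  refine (le_abs_self _).trans ?_
  rw [abs_mul, abs_sub_comm (q x), div_eq_mul_inv]
  refine mul_le_mul_of_nonneg_left ?_ (abs_nonneg _)
  rw [abs_le]
  constructor <;> linarith [hg0 x, hg1 x]

lemma one_sub_le_tvDist_rLaw {β : ℝ} (hβ : 0 ≤ β) {n : ℕ} (hn : 0 < n) {a : Fin n → ℝ}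
    (ha : ∀ i, |a i| ≤ 1) (hsum : ∑ i, a i = 0) (σ : Config n) (t : ℕ)
    {A : ℝ} (hA : A = (1 - 1 / n) ^ t * overlap a σ) (hA0 : 0 < A) :
    1 - (24 * n + 8 * β * A) / A ^ 2 ≤ tvDist (rLaw β n t σ) (muPlus β n) := by
  classical
  let g : Config n → ℝ := fun η => if overlap a η ^ 2 < A ^ 2 / 4 then 1 else 0
  have hg : ∀ η, g (negConfig η) = g η := fun η => by simp [g, overlap_negConfig]
  have hA2 : 0 < A ^ 2 := by positivity
  have h1 : ∑ η, rLaw β n t σ η * g η ≤ 4 * (4 * n + 2 * β * A) / A ^ 2 := by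
    rw [sum_rLaw_mul β t σ g hg]
    have hpt : ∀ η, g η ≤ 4 / A ^ 2 * (overlap a η ^ 2 - 2 * A * overlap a η + A ^ 2) := by
      intro η
      have hsq : overlap a η ^ 2 - 2 * A * overlap a η + A ^ 2 = (overlap a η - A) ^ 2 := by ring
      rw [hsq]
      by_cases h : overlap a η ^ 2 < A ^ 2 / 4
      · have h2 : overlap a η < A / 2 := by
          refine lt_of_pow_lt_pow_left₀ 2 (by positivity) ?_
          linarith
        simp only [g, if_pos h]
        rw [div_mul_eq_mul_div, le_div_iff₀ hA2]
        nlinarith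
      · simp only [g, if_neg h]
        positivity
    calc ∑ η, glauberLaw β n t σ η * g η
        ≤ ∑ η, glauberLaw β n t σ η *
            (4 / A ^ 2 * (overlap a η ^ 2 - 2 * A * overlap a η + A ^ 2)) :=
          Finset.sum_le_sum fun η _ =>
            mul_le_mul_of_nonneg_left (hpt η) (glauberLaw_nonneg β t σ η)
      _ = 4 / A ^ 2 * (∑ η, glauberLaw β n t σ η * overlap a η ^ 2 -
            2 * A * ∑ η, glauberLaw β n t σ η * overlap a η + A ^ 2) := by
          have : ∀ η, glauberLaw β n t σ η *
              (4 / A ^ 2 * (overlap a η ^ 2 - 2 * A * overlap a η + A ^ 2)) =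
              4 / A ^ 2 * (glauberLaw β n t σ η * overlap a η ^ 2 -
                2 * A * (glauberLaw β n t σ η * overlap a η) + glauberLaw β n t σ η * A ^ 2) :=
            fun η => by ring
          simp only [this, Finset.sum_sub_distrib, Finset.sum_add_distrib, ← Finset.mul_sum,
            ← Finset.sum_mul, sum_glauberLaw β hn, one_mul]
      _ ≤ 4 / A ^ 2 * ((A ^ 2 + 4 * n) - 2 * A * (A - β) + A ^ 2) := by
          have e1 := le_sum_glauberLaw_mul_overlap hβ hn ha hsum σ t
          have e2 := sum_glauberLaw_mul_overlap_sq_le hβ hn ha hsum σ t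
          rw [← hA] at e1 e2
          gcongr
      _ = 4 * (4 * n + 2 * β * A) / A ^ 2 := by ring
  have h2 : 1 - 4 * (2 * n) / A ^ 2 ≤ ∑ η, muPlus β n η * g η := by
    rw [sum_muPlus_mul_of_even β g hg]
    have hpt : ∀ η, 1 - 4 / A ^ 2 * overlap a η ^ 2 ≤ g η := by
      intro η
      by_cases h : overlap a η ^ 2 < A ^ 2 / 4
      · simp only [g, if_pos h]
        have : 0 ≤ 4 / A ^ 2 * overlap a η ^ 2 := by positivity
        linarith
      · simp only [g, if_neg h]
        rw [sub_nonpos, div_mul_eq_mul_div, le_div_iff₀ hA2]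
        linarith
    calc 1 - 4 * (2 * n) / A ^ 2
        ≤ 1 - 4 / A ^ 2 * ∑ η, cwMeasure β n η * overlap a η ^ 2 := by
          rw [mul_div_right_comm]
          gcongr
          exact sum_cwMeasure_mul_overlap_sq_le hβ hn ha hsum
      _ = ∑ η, cwMeasure β n η * (1 - 4 / A ^ 2 * overlap a η ^ 2) := by
          simp only [mul_sub, Finset.sum_sub_distrib, mul_one, sum_cwMeasure, Finset.mul_sum]
          congr 1
          exact Finset.sum_congr rfl fun η _ => by ring
      _ ≤ _ := Finset.sum_le_sum fun η _ =>
          mul_le_mul_of_nonneg_left (hpt η) (cwMeasure_nonneg β η)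
  have h3 := sum_sub_mul_le_tvDist (sum_rLaw β hn t σ) (sum_muPlus β n) (g := g)
    (fun η => by simp only [g]; split_ifs <;> norm_num)
    (fun η => by simp only [g]; split_ifs <;> norm_num)
  have h4 : (24 * n + 8 * β * A) / A ^ 2 =
      4 * (4 * n + 2 * β * A) / A ^ 2 + 4 * (2 * n) / A ^ 2 := by ring
  linarith

/-- A balanced weight vector, together with a configuration of non-negative magnetization which
is almost completely aligned with it. -/
lemma exists_balanced_weights (n : ℕ) :
    ∃ (a : Fin n → ℝ) (σ : Config n), (∀ i, |a i| ≤ 1) ∧ ∑ i, a i = 0 ∧ 0 ≤ mag σ ∧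
      (n : ℝ) - 1 ≤ overlap a σ := by
  classical
  let a : Fin n → ℝ := fun i =>
    if 2 * (i : ℕ) + 1 < n then 1 else if 2 * (i : ℕ) + 1 = n then 0 else -1
  let σ : Config n := fun i => decide (2 * (i : ℕ) + 1 ≤ n)
  have hsum : ∑ i, a i = 0 := by
    have h : ∑ i, a (Fin.rev i) = ∑ i, a i := Equiv.sum_comp Fin.revPerm a
    have h' : ∀ i, a (Fin.rev i) = -a i := by
      intro i
      have := i.isLt
      simp only [a, Fin.val_rev]
      split_ifs <;> first | omega | norm_num
    simp only [h', Finset.sum_neg_distrib] at h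
    linarith
  refine ⟨a, σ, fun i => ?_, hsum, ?_, ?_⟩
  · simp only [a]
    split_ifs <;> simp
  · unfold mag
    refine div_nonneg ?_ (Nat.cast_nonneg n)
    rw [← hsum]
    refine Finset.sum_le_sum fun i _ => ?_
    simp only [a, spin, σ, decide_eq_true_eq]
    split_ifs <;> first | omega | norm_num
  · have h : ∀ i : Fin n, 1 - (if 2 * (i : ℕ) + 1 = n then 1 else 0) ≤ a i * spin σ i := by
      intro i
      simp only [a, spin, σ, decide_eq_true_eq]
      split_ifs <;> first | omega | norm_num
    have hcard : (Finset.univ.filter fun i : Fin n => 2 * (i : ℕ) + 1 = n).card ≤ 1 := by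
      refine Finset.card_le_one.2 fun i hi j hj => ?_
      simp only [Finset.mem_filter, Finset.mem_univ, true_and] at hi hj
      exact Fin.ext (by omega)
    have hle := Finset.sum_le_sum fun i (_ : i ∈ Finset.univ) => h i
    rw [Finset.sum_sub_distrib, Finset.sum_boole] at hle
    simp only [Finset.sum_const, Finset.card_univ, Fintype.card_fin, nsmul_eq_mul, mul_one] at hle
    have hcard' : ((Finset.univ.filter fun i : Fin n => 2 * (i : ℕ) + 1 = n).card : ℝ) ≤ 1 := by
      exact_mod_cast hcard
    unfold overlap
    linarith

/-- Before time `(1/4) n log n` the factor `(1 - 1/n)ᵗ` exceeds `n^(-3/8)`. -/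
lemma le_one_sub_inv_pow {n t : ℕ} (hn : 3 ≤ n) (ht : (t : ℝ) ≤ 1 / 4 * n * Real.log n) :
    Real.exp (-(3 / 8 * Real.log n)) ≤ (1 - 1 / (n : ℝ)) ^ t := by
  have hn' : (3 : ℝ) ≤ n := by exact_mod_cast hn
  have h1 : Real.exp (-(1 / ((n : ℝ) - 1))) ≤ 1 - 1 / n := by
    rw [Real.exp_neg, inv_le_comm₀ (Real.exp_pos _)
      (by rw [sub_pos, div_lt_one (by linarith)]; linarith)]
    have h := Real.add_one_le_exp (1 / ((n : ℝ) - 1))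
    have h' : (1 - 1 / (n : ℝ))⁻¹ = 1 / ((n : ℝ) - 1) + 1 := by
      have : (n : ℝ) - 1 ≠ 0 := by linarith
      have : (n : ℝ) ≠ 0 := by linarith
      field_simp
      ring
    rwa [h']
  calc Real.exp (-(3 / 8 * Real.log n)) ≤ Real.exp (t * -(1 / ((n : ℝ) - 1))) := by
        refine Real.exp_le_exp.2 ?_
        rw [mul_neg, neg_le_neg_iff, mul_one_div, div_le_iff₀ (by linarith)]
        have hlog : 0 ≤ Real.log n := Real.log_nonneg (by linarith)
        nlinarith
    _ = Real.exp (-(1 / ((n : ℝ) - 1))) ^ t := Real.exp_nat_mul _ _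
    _ ≤ _ := pow_le_pow_left₀ (Real.exp_pos _).le h1 t

lemma lt_rDist {β : ℝ} (hβ : 0 ≤ β) {n t : ℕ} (hn : 3 ≤ n)
    (hnβ : (160 + 64 * β) ^ 4 ≤ (n : ℝ)) (ht : (t : ℝ) ≤ 1 / 4 * n * Real.log n) :
    1 / 4 < rDist β n t := by
  obtain ⟨a, σ, ha, hsum, hσ, hov⟩ := exists_balanced_weights n
  have hn' : (3 : ℝ) ≤ n := by exact_mod_cast hn
  set A := (1 - 1 / (n : ℝ)) ^ t * overlap a σ with hA
  have hpow := le_one_sub_inv_pow hn ht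
  have hlow : Real.exp (-(3 / 8 * Real.log n)) * (n / 2) ≤ A := by
    rw [hA]
    exact mul_le_mul hpow (by linarith) (by positivity) ((Real.exp_pos _).le.trans hpow)
  have hA0 : 0 < A := lt_of_lt_of_le (by positivity) hlow
  have hAn : A ≤ n := by
    have h1 : (1 - 1 / (n : ℝ)) ^ t ≤ 1 := by
      refine pow_le_one₀ ?_ ?_
      · rw [sub_nonneg, div_le_one (by linarith)]
        linarith
      · have : 0 ≤ 1 / (n : ℝ) := by positivity
        linarith
    have h2 := (abs_le.1 (abs_overlap_le ha σ)).2
    calc A ≤ 1 * overlap a σ := mul_le_mul_of_nonneg_right h1 (by linarith)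
      _ ≤ n := by linarith
  have hA2 : (40 + 16 * β) * n ≤ A ^ 2 := by
    have hroot : 160 + 64 * β ≤ Real.exp (1 / 4 * Real.log n) := by
      refine le_of_pow_le_pow_left₀ (n := 4) (by norm_num) (Real.exp_pos _).le ?_
      rw [← Real.exp_nat_mul]
      have : ((4 : ℕ) : ℝ) * (1 / 4 * Real.log n) = Real.log n := by
        push_cast
        ring
      rwa [this, Real.exp_log (by linarith)]
    have hsq : (Real.exp (-(3 / 8 * Real.log n)) * (n / 2)) ^ 2 =
        Real.exp (1 / 4 * Real.log n) * n / 4 := by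
      have h1 : Real.exp (-(3 / 8 * Real.log n)) ^ 2 * n = Real.exp (1 / 4 * Real.log n) := by
        rw [← Real.exp_nat_mul]
        nth_rewrite 2 [← Real.exp_log (by linarith : (0 : ℝ) < n)]
        rw [← Real.exp_add]
        congr 1
        push_cast
        ring
      rw [← h1]
      ring
    have h3 : (Real.exp (-(3 / 8 * Real.log n)) * (n / 2)) ^ 2 ≤ A ^ 2 := by gcongr
    rw [hsq] at h3
    nlinarith
  have htv := one_sub_le_tvDist_rLaw hβ (by omega) ha hsum σ t hA hA0
  have hfrac : (24 * n + 8 * β * A) / A ^ 2 < 3 / 4 := by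
    rw [div_lt_iff₀ (by positivity)]
    have : β * A ≤ β * n := mul_le_mul_of_nonneg_left hAn hβ
    have : 0 ≤ β * n := by positivity
    nlinarith
  have hsup : tvDist (rLaw β n t σ) (muPlus β n) ≤ rDist β n t :=
    le_ciSup (f := fun σ : {σ : Config n // 0 ≤ mag σ} => tvDist (rLaw β n t σ.1) (muPlus β n))
      (Set.finite_range _).bddAbove ⟨σ, hσ⟩
  linarith

/-- Lower bound for the mixing time of the restricted low-temperature
dynamics: for `β > 1`, `t_mix(n) ≥ (1/4) n log n` for all large `n`. -/
theorem cw_lowtemp_lower (β : ℝ) (hβ : 1 < β) :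
    ∃ N : ℕ, ∀ n ≥ N, (1 / 4 : ℝ) * n * Real.log n ≤ (rTMix β n : ℝ) := by
  refine ⟨max 3 ⌈(160 + 64 * β) ^ 4⌉₊, fun n hn => ?_⟩
  have hn3 : 3 ≤ n := (le_max_left _ _).trans hn
  have hnβ : (160 + 64 * β) ^ 4 ≤ (n : ℝ) := Nat.ceil_le.1 ((le_max_right _ _).trans hn)
  have hmem : rDist β n (rTMix β n) ≤ 1 / 4 := Nat.sInf_mem (exists_rDist_le β (by omega))
  by_contra! hlt
  exact absurd (lt_rDist (by linarith) hn3 hnβ hlt.le) hmem.not_gt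

end

end CW
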